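/- Let M be a compact metric space, f a continuous flow on M, γ : M → (0,∞) continuous, and g the time change of f with speed multiplier γ. Then: (1) for every f-invariant ergodic Borel probability measure ν on M, ν^γ is the unique g-invariant ergodic Borel probability measure that is equivalent to ν (i.e. mutually absolutely continuous with ν); and (2) every g-invariant ergodic Borel probability measure on M has the form ν^γ for some f-invariant ergodic Borel probability measure ν. -/

import Mathlib

open MeasureTheory intervalIntegral

/-- The additive cocycle over the flow `g` generated by `γ`:
`τ(t,x) = ∫₀^t γ(g^s x) ds`. -/
noncomputable def addCocycle {M : Type*} [TopologicalSpace M] (g : Flow ℝ M) (γ : M → ℝ)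
    (t : ℝ) (x : M) : ℝ :=
  ∫ s in (0 : ℝ)..t, γ (g s x)

/-- The flow `g` is a time change of `f` with speed multiplier `γ`. -/
def IsTimeChange {M : Type*} [TopologicalSpace M] (f g : Flow ℝ M) (γ : M → ℝ) : Prop :=
  ∀ t x, g t x = f (addCocycle g γ t x) x

/-- A measure `ν` is invariant under the flow `f`. -/
def FlowInvariant {M : Type*} [TopologicalSpace M] [MeasurableSpace M] (f : Flow ℝ M)
    (ν : Measure M) : Prop :=
  ∀ t : ℝ, MeasurePreserving (f t) ν ν

/-- The flow `f` is ergodic with respect to `ν`: every Borel set invariant under the whole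
flow has measure `0` or `1`. -/
def FlowErgodic {M : Type*} [TopologicalSpace M] [MeasurableSpace M] (f : Flow ℝ M)
    (ν : Measure M) : Prop :=
  ∀ J : Set M, MeasurableSet J → (∀ t : ℝ, f t '' J = J) → ν J = 0 ∨ ν J = 1

/-- The measure `ν^γ`, with Radon–Nikodym derivative
`dν^γ/dν = γ⁻¹ · (∫ γ⁻¹ dν)⁻¹`. -/
noncomputable def nuGamma {M : Type*} [MeasurableSpace M] (ν : Measure M) (γ : M → ℝ) :
    Measure M :=
  ν.withDensity fun x => ENNReal.ofReal ((γ x)⁻¹ / ∫ y, (γ y)⁻¹ ∂ν)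

theorem nuGamma_absolutelyContinuous {M : Type*} [MeasurableSpace M] (ν : Measure M) (γ : M → ℝ) :
    nuGamma ν γ ≪ ν :=
  withDensity_absolutelyContinuous _ _

section TimeChange

variable {M : Type*} [MetricSpace M]

theorem continuous_orbit (f : Flow ℝ M) (x : M) : Continuous fun t : ℝ => f t x :=
  f.continuous continuous_id continuous_const

theorem hasDerivAt_addCocycle (g : Flow ℝ M) {γ : M → ℝ} (hγ : Continuous γ) (x : M) (t : ℝ) :
    HasDerivAt (fun t => addCocycle g γ t x) (γ (g t x)) t :=
  (hγ.comp (continuous_orbit g x)).integral_hasStrictDerivAt 0 t |>.hasDerivAt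

theorem addCocycle_zero (g : Flow ℝ M) (γ : M → ℝ) (x : M) : addCocycle g γ 0 x = 0 := by
  simp [addCocycle]

theorem integral_comp_timeChange {f g : Flow ℝ M} {γ : M → ℝ} (hγ : Continuous γ)
    (hg : IsTimeChange f g γ) {ψ : M → ℝ} (hψ : Continuous ψ) (x : M) (t : ℝ) :
    ∫ r in (0 : ℝ)..t, ψ (g r x) * γ (g r x) = ∫ u in (0 : ℝ)..addCocycle g γ t x, ψ (f u x) := by
  have h := integral_comp_mul_deriv (a := 0) (b := t) (g := fun u => ψ (f u x))
    (fun r _ => hasDerivAt_addCocycle g hγ x r)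
    (hγ.comp (continuous_orbit g x)).continuousOn (hψ.comp (continuous_orbit f x))
  rw [addCocycle_zero] at h
  rw [← h]
  simp only [Function.comp_apply, ← hg _ x]

theorem addCocycle_surjective [CompactSpace M] (g : Flow ℝ M) {γ : M → ℝ} (hγ : Continuous γ)
    (hpos : ∀ x, 0 < γ x) (x : M) : Function.Surjective fun t => addCocycle g γ t x := by
  obtain ⟨x₀, -, hx₀⟩ :=
    isCompact_univ.exists_isMinOn ⟨x, Set.mem_univ x⟩ hγ.continuousOn
  set c := γ x₀
  have hc : 0 < c := hpos x₀
  have hder (t : ℝ) :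
      HasDerivAt (fun t => addCocycle g γ t x - c * t) (γ (g t x) - c) t := by
    have h := (hasDerivAt_addCocycle g hγ x t).sub ((hasDerivAt_id t).const_mul c)
    rw [mul_one] at h
    exact h
  have hmono : Monotone fun t => addCocycle g γ t x - c * t := by
    refine monotone_of_deriv_nonneg (fun t => (hder t).differentiableAt) fun t => ?_
    rw [(hder t).deriv, sub_nonneg]
    exact hx₀ (Set.mem_univ _)
  have hcont : Continuous fun t => addCocycle g γ t x :=
    continuous_iff_continuousAt.2 fun t => (hasDerivAt_addCocycle g hγ x t).continuousAt
  intro s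
  have hcs : c * (|s| / c) = |s| := by field_simp
  have hb := hmono (show (0 : ℝ) ≤ |s| / c by positivity)
  have ha := hmono (show -(|s| / c) ≤ 0 from neg_nonpos.2 (by positivity))
  simp only [addCocycle_zero, mul_neg, hcs] at ha hb
  exact mem_range_of_exists_le_of_exists_ge hcont
    ⟨-(|s| / c), by linarith [neg_abs_le s]⟩ ⟨|s| / c, by linarith [le_abs_self s]⟩

theorem IsTimeChange.symm [CompactSpace M] {f g : Flow ℝ M} {γ : M → ℝ} (hγ : Continuous γ)
    (hpos : ∀ x, 0 < γ x) (hg : IsTimeChange f g γ) :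
    IsTimeChange g f fun x => (γ x)⁻¹ := by
  intro s x
  obtain ⟨t, rfl⟩ := addCocycle_surjective g hγ hpos x s
  have h := integral_comp_timeChange hγ hg (ψ := fun x => (γ x)⁻¹)
    (hγ.inv₀ fun x => (hpos x).ne') x t
  have ht : addCocycle f (fun x => (γ x)⁻¹) (addCocycle g γ t x) x = t := by
    rw [addCocycle, ← h]
    simp [inv_mul_cancel₀ (hpos _).ne']
  simp only
  rw [ht, hg]

theorem IsTimeChange.isInvariant {f g : Flow ℝ M} {γ : M → ℝ} (hg : IsTimeChange f g γ)
    {J : Set M} (hJ : ∀ t, f t '' J = J) (t : ℝ) : g t '' J = J := by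
  rw [← Flow.isInvariant_iff_image_eq] at hJ
  refine (Flow.isInvariant_iff_image_eq g J).1 (fun t x hx => ?_) t
  rw [hg]
  exact hJ _ hx

theorem abs_integral_translate_sub_le {ψ : ℝ → ℝ} (hψ : Continuous ψ) {C : ℝ}
    (hC : ∀ u, |ψ u| ≤ C) (s a b : ℝ) :
    |∫ u in a..b, (ψ (u + s) - ψ u)| ≤ 2 * C * |s| := by
  have hi (p q : ℝ) : IntervalIntegrable ψ volume p q := hψ.intervalIntegrable p q
  have hbound (p : ℝ) : |∫ u in p..p + s, ψ u| ≤ C * |s| := by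
    simpa using norm_integral_le_of_norm_le_const (a := p) (b := p + s) (f := ψ) (C := C)
      fun u _ => hC u
  have hsplit : ∫ u in a..b, (ψ (u + s) - ψ u) =
      (∫ u in b..b + s, ψ u) - ∫ u in a..a + s, ψ u := by
    have hshift : Continuous fun u => ψ (u + s) := hψ.comp (continuous_add_const s)
    rw [intervalIntegral.integral_sub (hshift.intervalIntegrable _ _) (hi _ _),
      integral_comp_add_right,
      integral_interval_sub_interval_comm (hi _ _) (hi _ _) (hi _ _),
      integral_symm b, integral_symm a]
    have h₁ := integral_add_adjacent_intervals (hi a (a + s)) (hi (a + s) (b + s))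
    ring
  rw [hsplit]
  have := abs_sub (∫ u in b..b + s, ψ u) (∫ u in a..a + s, ψ u)
  linarith [hbound a, hbound b]

theorem measurable_nuGamma_density [MeasurableSpace M] [BorelSpace M] {ν : Measure M} {γ : M → ℝ}
    (hγ : Continuous γ) :
    Measurable fun x => ENNReal.ofReal ((γ x)⁻¹ / ∫ y, (γ y)⁻¹ ∂ν) :=
  (hγ.measurable.inv.div_const _).ennreal_ofReal

variable [CompactSpace M] [MeasurableSpace M] [BorelSpace M]

theorem integrable_of_continuous_of_compactSpace {μ : Measure M} [IsFiniteMeasure μ]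
    {ψ : M → ℝ} (hψ : Continuous ψ) : Integrable ψ μ :=
  hψ.integrable_of_hasCompactSupport (HasCompactSupport.of_compactSpace ψ)

theorem measurable_uncurry_flow (g : Flow ℝ M) : Measurable fun p : ℝ × M => g p.1 p.2 :=
  have := UniformSpace.secondCountable_of_separable M
  (g.continuous continuous_fst continuous_snd).measurable

theorem FlowInvariant.integral_intervalIntegral {g : Flow ℝ M} {μ : Measure M}
    [IsFiniteMeasure μ] (hμ : FlowInvariant g μ) {ψ : M → ℝ} (hψ : Continuous ψ) (T : ℝ) :
    ∫ x, (∫ r in (0 : ℝ)..T, ψ (g r x)) ∂μ = T * ∫ x, ψ x ∂μ := by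
  obtain ⟨C, hC⟩ := isCompact_univ.exists_bound_of_continuousOn hψ.continuousOn
  have hintegrable : Integrable (Function.uncurry fun r x => ψ (g r x))
      ((volume.restrict (Set.uIoc 0 T)).prod μ) := by
    have : IsFiniteMeasure (volume.restrict (Set.uIoc 0 T)) :=
      isFiniteMeasure_restrict.2 (by simp [Set.uIoc])
    refine Integrable.of_bound
      (hψ.measurable.comp (measurable_uncurry_flow g)).aestronglyMeasurable C ?_
    exact Filter.Eventually.of_forall fun p => hC _ (Set.mem_univ _)
  rw [← intervalIntegral_integral_swap hintegrable]
  have (r : ℝ) : ∫ x, ψ (g r x) ∂μ = ∫ x, ψ x ∂μ := by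
    have h := integral_map (μ := μ) (hμ r).measurable.aemeasurable (f := ψ)
      hψ.measurable.aestronglyMeasurable
    rw [← h, (hμ r).map_eq]
  simp [this]

theorem FlowInvariant.integral_timeChange {f g : Flow ℝ M} {γ : M → ℝ} (hγ : Continuous γ)
    (hg : IsTimeChange f g γ) {μ : Measure M} [IsFiniteMeasure μ] (hμ : FlowInvariant g μ)
    {φ : M → ℝ} (hφ : Continuous φ) (s : ℝ) :
    ∫ x, φ (f s x) * γ x ∂μ = ∫ x, φ x * γ x ∂μ := by
  obtain ⟨C, hC⟩ := isCompact_univ.exists_bound_of_continuousOn hφ.continuousOn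
  have hfs : Continuous (f s) := f.continuous continuous_const continuous_id
  have hψ : Continuous fun x => φ (f s x) - φ x := (hφ.comp hfs).sub hφ
  set D := ∫ x, (φ (f s x) - φ x) * γ x ∂μ with hD
  have hTD (T : ℝ) : |T * D| ≤ 2 * C * |s| * μ.real Set.univ := by
    have hψγ : Continuous fun x => (φ (f s x) - φ x) * γ x := hψ.mul hγ
    rw [hD, ← hμ.integral_intervalIntegral hψγ T]
    rw [← Real.norm_eq_abs]
    refine MeasureTheory.norm_integral_le_of_norm_le_const (Filter.Eventually.of_forall fun x => ?_)
    rw [integral_comp_timeChange hγ hg hψ]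
    simp only [← f.map_add]
    simp only [add_comm s]
    exact abs_integral_translate_sub_le (hφ.comp (continuous_orbit f x))
      (fun u => hC _ (Set.mem_univ _)) s _ _
  have hD0 : D = 0 := by
    by_contra h
    have := hTD ((2 * C * |s| * μ.real Set.univ + 1) / D)
    rw [div_mul_cancel₀ _ h] at this
    linarith [le_abs_self (2 * C * |s| * μ.real Set.univ + 1)]
  have h₁ : Continuous fun x => φ (f s x) * γ x := (hφ.comp hfs).mul hγ
  have h₂ : Continuous fun x => φ x * γ x := hφ.mul hγ
  rw [← sub_eq_zero, ← MeasureTheory.integral_sub (integrable_of_continuous_of_compactSpace h₁)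
    (integrable_of_continuous_of_compactSpace h₂), ← hD0]
  simp only [hD, sub_mul]

theorem integral_inv_pos {ν : Measure M} [IsProbabilityMeasure ν] {γ : M → ℝ}
    (hγ : Continuous γ) (hpos : ∀ x, 0 < γ x) : 0 < ∫ x, (γ x)⁻¹ ∂ν := by
  have hinv : Continuous fun x => (γ x)⁻¹ := hγ.inv₀ fun x => (hpos x).ne'
  rw [integral_pos_iff_support_of_nonneg (fun x => (inv_pos.2 (hpos x)).le)
    (integrable_of_continuous_of_compactSpace hinv)]
  have : (Function.support fun x => (γ x)⁻¹) = Set.univ :=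
    Set.eq_univ_of_forall fun x => (inv_pos.2 (hpos x)).ne'
  simp [this]

theorem isProbabilityMeasure_nuGamma {ν : Measure M} [IsProbabilityMeasure ν] {γ : M → ℝ}
    (hγ : Continuous γ) (hpos : ∀ x, 0 < γ x) : IsProbabilityMeasure (nuGamma ν γ) := by
  have hinv : Continuous fun x => (γ x)⁻¹ := hγ.inv₀ fun x => (hpos x).ne'
  have hI := integral_inv_pos (ν := ν) hγ hpos
  constructor
  rw [nuGamma, withDensity_apply _ .univ, setLIntegral_univ,
    ← ofReal_integral_eq_lintegral_ofReal
      (integrable_of_continuous_of_compactSpace (hinv.div_const _))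
      (Filter.Eventually.of_forall fun x => (div_pos (inv_pos.2 (hpos x)) hI).le),
    MeasureTheory.integral_div, div_self hI.ne', ENNReal.ofReal_one]

theorem integral_nuGamma {ν : Measure M} [IsProbabilityMeasure ν] {γ : M → ℝ}
    (hγ : Continuous γ) (hpos : ∀ x, 0 < γ x) (φ : M → ℝ) :
    ∫ x, φ x ∂nuGamma ν γ = (∫ y, (γ y)⁻¹ ∂ν)⁻¹ * ∫ x, φ x * (γ x)⁻¹ ∂ν := by
  have hI := integral_inv_pos (ν := ν) hγ hpos
  rw [nuGamma, integral_withDensity_eq_integral_toReal_smul (measurable_nuGamma_density hγ)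
    (Filter.Eventually.of_forall fun x => ENNReal.ofReal_lt_top),
    ← MeasureTheory.integral_const_mul]
  refine integral_congr_ae (Filter.Eventually.of_forall fun x => ?_)
  simp only [ENNReal.toReal_ofReal (div_pos (inv_pos.2 (hpos x)) hI).le, smul_eq_mul]
  ring

theorem absolutelyContinuous_nuGamma {ν : Measure M} [IsProbabilityMeasure ν] {γ : M → ℝ}
    (hγ : Continuous γ) (hpos : ∀ x, 0 < γ x) : ν ≪ nuGamma ν γ :=
  withDensity_absolutelyContinuous' (measurable_nuGamma_density hγ).aemeasurable
    (Filter.Eventually.of_forall fun x => (ENNReal.ofReal_pos.2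
      (div_pos (inv_pos.2 (hpos x)) (integral_inv_pos hγ hpos))).ne')

theorem flowInvariant_nuGamma {f g : Flow ℝ M} {γ : M → ℝ} (hγ : Continuous γ)
    (hpos : ∀ x, 0 < γ x) (hg : IsTimeChange f g γ) {ν : Measure M} [IsProbabilityMeasure ν]
    (hν : FlowInvariant f ν) : FlowInvariant g (nuGamma ν γ) := by
  intro t
  have hgt : Continuous (g t) := g.continuous continuous_const continuous_id
  have hinv : Continuous fun x => (γ x)⁻¹ := hγ.inv₀ fun x => (hpos x).ne'
  have := isProbabilityMeasure_nuGamma (ν := ν) hγ hpos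
  refine ⟨hgt.measurable, ?_⟩
  refine ext_of_forall_integral_eq_of_IsFiniteMeasure fun φ => ?_
  rw [integral_map hgt.measurable.aemeasurable φ.continuous.measurable.aestronglyMeasurable,
    integral_nuGamma hγ hpos, integral_nuGamma hγ hpos,
    hν.integral_timeChange hinv (hg.symm hγ hpos) φ.continuous]

theorem flowErgodic_nuGamma {f g : Flow ℝ M} {γ : M → ℝ} (hγ : Continuous γ)
    (hpos : ∀ x, 0 < γ x) (hg : IsTimeChange f g γ) {ν : Measure M} [IsProbabilityMeasure ν]
    (hν : FlowErgodic f ν) : FlowErgodic g (nuGamma ν γ) := by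
  intro J hJm hJ
  have := isProbabilityMeasure_nuGamma (ν := ν) hγ hpos
  have hac := nuGamma_absolutelyContinuous ν γ
  refine (hν J hJm ((hg.symm hγ hpos).isInvariant hJ)).imp (fun h => hac h) fun h => ?_
  rw [← prob_compl_eq_zero_iff hJm] at h ⊢
  exact hac h

theorem nuGamma_nuGamma_inv {μ : Measure M} [IsProbabilityMeasure μ] {γ : M → ℝ}
    (hγ : Continuous γ) (hpos : ∀ x, 0 < γ x) :
    nuGamma (nuGamma μ fun x => (γ x)⁻¹) γ = μ := by
  have hinv : Continuous fun x => (γ x)⁻¹ := hγ.inv₀ fun x => (hpos x).ne'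
  have hposinv (x : M) : 0 < (γ x)⁻¹ := inv_pos.2 (hpos x)
  have := isProbabilityMeasure_nuGamma (ν := μ) hinv hposinv
  have := isProbabilityMeasure_nuGamma (ν := nuGamma μ fun x => (γ x)⁻¹) hγ hpos
  have hI := integral_inv_pos (ν := μ) hinv hposinv
  refine ext_of_forall_integral_eq_of_IsFiniteMeasure fun φ => ?_
  rw [integral_nuGamma hγ hpos, integral_nuGamma hinv hposinv, integral_nuGamma hinv hposinv]
  have hne (x : M) : γ x ≠ 0 := (hpos x).ne'
  simp only [inv_inv, mul_assoc, inv_mul_cancel₀ (hne _)] at hI ⊢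
  simp [hI.ne']

theorem FlowErgodic.measure_eq_zero_or_one_of_ae_invariant {g : Flow ℝ M} {ν : Measure M}
    [IsProbabilityMeasure ν] (hν : FlowErgodic g ν) {A : Set M} (hA : MeasurableSet A)
    (hAg : ∀ t, ∀ᵐ x ∂ν, g t x ∈ A ↔ x ∈ A) : ν A = 0 ∨ ν A = 1 := by
  have hmeas : MeasurableSet {p : ℝ × M | g p.1 p.2 ∈ A} := measurable_uncurry_flow g hA
  set J : Set M := {x | ∀ᵐ t : ℝ, g t x ∈ A} with hJdef
  have hJm : MeasurableSet J :=
    measurable_measure_prodMk_right hmeas.compl (measurableSet_singleton 0)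
  have hJ (t : ℝ) : g t '' J = J := by
    refine (Flow.isInvariant_iff_image_eq g J).1 (fun s x hx => ?_) t
    have := (measurePreserving_add_right volume s).quasiMeasurePreserving.ae hx
    simpa [hJdef, g.map_add] using this
  have hswap : ∀ᵐ x ∂ν, ∀ᵐ t : ℝ, (g t x ∈ A ↔ x ∈ A) := by
    refine (Measure.ae_ae_comm ?_).1 (Filter.Eventually.of_forall hAg)
    have hAm : MeasurableSet {p : ℝ × M | p.2 ∈ A} := measurable_snd hA
    exact hmeas.iff hAm
  have hJA : J =ᵐ[ν] A := by
    filter_upwards [hswap] with x hx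
    refine propext ⟨fun h => ?_, fun h => ?_⟩
    · obtain ⟨t, ht₁, ht₂⟩ := (hx.and h).exists
      exact ht₁.1 ht₂
    · filter_upwards [hx] with t ht using ht.2 h
  rw [← measure_congr hJA]
  exact hν J hJm hJ

theorem FlowErgodic.eq_of_absolutelyContinuous {g : Flow ℝ M} {μ ν : Measure M}
    [IsProbabilityMeasure μ] [IsProbabilityMeasure ν] (hν : FlowErgodic g ν)
    (hνg : FlowInvariant g ν) (hμg : FlowInvariant g μ) (hμν : μ ≪ ν) : μ = ν := by
  set h := μ.rnDeriv ν
  have hm : Measurable h := Measure.measurable_rnDeriv μ ν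
  have hμh : ν.withDensity h = μ := Measure.withDensity_rnDeriv_eq μ ν hμν
  have htotal : ∫⁻ x, h x ∂ν = 1 := by
    rw [← setLIntegral_univ, ← withDensity_apply _ .univ, hμh, measure_univ]
  have hA : MeasurableSet {x | h x < 1} := hm measurableSet_Iio
  have hge : ∀ᵐ x ∂ν, 1 ≤ h x := by
    rcases hν.measure_eq_zero_or_one_of_ae_invariant hA fun t => by
      filter_upwards [(hμg t).rnDeriv_comp_aeEq (hνg t)] with x hx
      simp only [Function.comp_apply] at hx
      simp [h, hx] with h0 | h1
    · simpa [ae_iff] using h0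
    · rw [← prob_compl_eq_zero_iff hA] at h1
      have hlt : ∀ᵐ x ∂ν, h x < 1 := h1
      have := lintegral_strict_mono (IsProbabilityMeasure.ne_zero ν) aemeasurable_const
        (by simp [htotal]) hlt
      simp [htotal] at this
  refine (Measure.eq_of_le_of_measure_univ_eq ?_ (by simp)).symm
  calc ν = ν.withDensity 1 := withDensity_one.symm
    _ ≤ ν.withDensity h := withDensity_mono hge
    _ = μ := hμh

end TimeChange

/-- (1) For every `f`-invariant ergodic Borel probability measure `ν`, the
measure `ν^γ` is the unique `g`-invariant ergodic Borel probability measure equivalent to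
`ν`; (2) every `g`-invariant ergodic Borel probability measure arises as `ν^γ` for some
`f`-invariant ergodic Borel probability measure `ν`. -/
theorem stmt7 {M : Type*} [MetricSpace M] [CompactSpace M]
    [MeasurableSpace M] [BorelSpace M]
    (f g : Flow ℝ M) (γ : M → ℝ) (hγc : Continuous γ) (hγpos : ∀ x, 0 < γ x)
    (hg : IsTimeChange f g γ) :
    (∀ ν : Measure M, IsProbabilityMeasure ν → FlowInvariant f ν → FlowErgodic f ν →
      IsProbabilityMeasure (nuGamma ν γ) ∧ FlowInvariant g (nuGamma ν γ) ∧
      FlowErgodic g (nuGamma ν γ) ∧ nuGamma ν γ ≪ ν ∧ ν ≪ nuGamma ν γ ∧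
      (∀ μ : Measure M, IsProbabilityMeasure μ → FlowInvariant g μ → FlowErgodic g μ →
        μ ≪ ν → ν ≪ μ → μ = nuGamma ν γ)) ∧
    (∀ μ : Measure M, IsProbabilityMeasure μ → FlowInvariant g μ → FlowErgodic g μ →
      ∃ ν : Measure M, IsProbabilityMeasure ν ∧ FlowInvariant f ν ∧ FlowErgodic f ν ∧
        μ = nuGamma ν γ) := by
  refine ⟨fun ν _ hνf hνe => ?_, fun μ _ hμg hμe => ?_⟩
  · have := isProbabilityMeasure_nuGamma (ν := ν) hγc hγpos
    have hinv := flowInvariant_nuGamma hγc hγpos hg hνf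
    have herg := flowErgodic_nuGamma hγc hγpos hg hνe
    have hac := absolutelyContinuous_nuGamma (ν := ν) hγc hγpos
    exact ⟨this, hinv, herg, nuGamma_absolutelyContinuous ν γ, hac,
      fun μ _ hμg _ hμν _ => herg.eq_of_absolutelyContinuous hinv hμg (hμν.trans hac)⟩
  · have hinvc : Continuous fun x => (γ x)⁻¹ := hγc.inv₀ fun x => (hγpos x).ne'
    have hinvpos (x : M) : 0 < (γ x)⁻¹ := inv_pos.2 (hγpos x)
    have hf := hg.symm hγc hγpos
    exact ⟨nuGamma μ fun x => (γ x)⁻¹, isProbabilityMeasure_nuGamma hinvc hinvpos,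
      flowInvariant_nuGamma hinvc hinvpos hf hμg, flowErgodic_nuGamma hinvc hinvpos hf hμe,
      (nuGamma_nuGamma_inv hγc hγpos).symm⟩
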